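/- ζ(5) + 2 Σ_{k=1}^∞ 1/(k⁵(e^{2πk} − 1)) + (π/2) Σ_{k=1}^∞ 1/(k⁴ sinh²(πk)) = 13π⁵/3780, where ζ is the Riemann zeta function. -/

import Mathlib

open Complex in
lemma coth_hasSum (x : ℝ) (hx : 0 < x) :
    HasSum (fun m : ℕ => 2 * x / (x ^ 2 + ((m : ℝ) + 1) ^ 2))
      (Real.pi * (1 + 2 / (Real.exp (2 * Real.pi * x) - 1)) - 1 / x) := by
  have hz : ((x : ℂ) * I) ∈ integerComplement :=
    UpperHalfPlane.coe_mem_integerComplement ⟨(x : ℂ) * I, by simpa using hx⟩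
  have h1 := (summable_cotTerm hz).hasSum
  have h2 := cot_series_rep' hz
  unfold cotTerm at h1
  rw [← h2] at h1
  have h3 := h1.mul_left I
  have hx0 : (x : ℂ) ≠ 0 := by exact_mod_cast hx.ne'
  have he : Real.exp (2 * Real.pi * x) ≠ 1 := by
    have : 0 < 2 * Real.pi * x := by positivity
    exact (Real.one_lt_exp_iff.mpr this).ne'
  have heC : cexp (2 * Real.pi * x) - 1 ≠ 0 := by
    intro h
    apply he
    rw [sub_eq_zero] at h
    exact_mod_cast h
  rw [← Complex.hasSum_ofReal]
  convert! h3 using 1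
  · funext m
    have hp : ((x : ℂ) ^ 2 + ((m : ℂ) + 1) ^ 2) ≠ 0 := by
      have : x ^ 2 + ((m : ℝ) + 1) ^ 2 ≠ 0 := by positivity
      exact_mod_cast this
    have a1 : ((x : ℂ) * I - (m + 1)) ≠ 0 := by
      intro h
      apply hp
      linear_combination (-(x : ℂ) * I - (m + 1)) * h + x ^ 2 * I_sq
    have a2 : ((x : ℂ) * I + (m + 1)) ≠ 0 := by
      intro h
      apply hp
      linear_combination (-(x : ℂ) * I + (m + 1)) * h + x ^ 2 * I_sq
    push_cast
    field_simp
    linear_combination (-2 * (x : ℂ) * (m + 1) ^ 2 ) * I_sq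
  · rw [cot_pi_eq_exp_ratio]
    have : (2 * Real.pi * I * (x * I) : ℂ) = -(2 * Real.pi * x) := by
      linear_combination (2 * Real.pi * x : ℂ) * I_sq
    rw [this, Complex.exp_neg]
    push_cast
    have e0 := Complex.exp_ne_zero (2 * Real.pi * x)
    generalize cexp (2 * Real.pi * x) = E at *
    have : 1 - E⁻¹ ≠ 0 := by
      intro h
      apply heC
      field_simp at h
      simpa using h
    field_simp
    ring

open Complex in
lemma sinh_hasSum (x : ℝ) (hx : 0 < x) :
    HasSum (fun m : ℕ => 2 * (((m : ℝ) + 1) ^ 2 - x ^ 2) / (x ^ 2 + ((m : ℝ) + 1) ^ 2) ^ 2)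
      (1 / x ^ 2 - Real.pi ^ 2 / Real.sinh (Real.pi * x) ^ 2) := by
  have h1 := EisensteinSeries.qExpansion_identity (k := 1) le_rfl ⟨(x : ℂ) * I, by simpa using hx⟩
  have hs : Summable (fun n : ℤ => 1 / ((x : ℂ) * I + n) ^ 2) := by
    have := EisensteinSeries.linear_right_summable ((x : ℂ) * I) 1 (k := 2) le_rfl
    refine this.congr fun n => ?_
    simp [zpow_ofNat]
  have h2 := hs.hasSum
  norm_num at h1
  norm_num at h2
  rw [h1] at h2
  have hx0 : (x : ℂ) ≠ 0 := by exact_mod_cast hx.ne'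
  have hq : ‖cexp (2 * Real.pi * I * (x * I))‖ < 1 := by
    rw [Complex.norm_exp]
    have : (2 * Real.pi * I * (x * I) : ℂ) = ((-(2 * Real.pi * x) : ℝ) : ℂ) := by
      push_cast
      linear_combination (2 * Real.pi * x : ℂ) * I_sq
    rw [this, ofReal_re, Real.exp_lt_one_iff]
    have : 0 < 2 * Real.pi * x := by positivity
    linarith
  rw [tsum_coe_mul_geometric_of_norm_lt_one hq] at h2
  have h3 := h2.nat_add_neg
  have h4 := (hasSum_nat_add_iff' 1).mpr h3
  have hS : Real.sinh (Real.pi * x) ≠ 0 := by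
    have : 0 < Real.sinh (Real.pi * x) := Real.sinh_pos_iff.mpr (by positivity)
    exact this.ne'
  rw [← Complex.hasSum_ofReal]
  convert! h4 using 1
  · funext m
    have hp : ((x : ℂ) ^ 2 + ((m : ℂ) + 1) ^ 2) ≠ 0 := by
      have : x ^ 2 + ((m : ℝ) + 1) ^ 2 ≠ 0 := by positivity
      exact_mod_cast this
    have a1 : ((x : ℂ) * I + -(m + 1)) ≠ 0 := by
      intro h
      apply hp
      linear_combination (-(x : ℂ) * I - (m + 1)) * h + x ^ 2 * I_sq
    have a2 : ((x : ℂ) * I + (m + 1)) ≠ 0 := by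
      intro h
      apply hp
      linear_combination (-(x : ℂ) * I + (m + 1)) * h + x ^ 2 * I_sq
    push_cast
    have e : ((x : ℂ) ^ 2 + ((m : ℂ) + 1) ^ 2) = -(((x : ℂ) * I + -(m + 1)) * ((x : ℂ) * I + (m + 1))) := by
      linear_combination x ^ 2 * I_sq
    have e2 : 2 * (((m : ℂ) + 1) ^ 2 - x ^ 2) = ((x : ℂ) * I + -(m + 1)) ^ 2 + ((x : ℂ) * I + (m + 1)) ^ 2 := by
      linear_combination -2 * x ^ 2 * I_sq
    rw [e, e2]
    field_simp
  · have e1 : (2 * Real.pi * I * (x * I) : ℂ) = -(Real.pi * x) + -(Real.pi * x) := by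
      linear_combination (2 * Real.pi * x : ℂ) * I_sq
    rw [e1, Complex.exp_add, Complex.exp_neg]
    have hSC : Complex.sinh (Real.pi * x) ≠ 0 := by exact_mod_cast hS
    push_cast
    rw [Complex.sinh, Complex.exp_neg] at *
    have e0 := Complex.exp_ne_zero (Real.pi * x)
    generalize cexp (Real.pi * x) = E at *
    have h5 : E ^ 2 - 1 ≠ 0 := by
      intro h
      apply hSC
      field_simp
      simpa using h
    simp [mul_pow]
    field_simp
    ring

lemma zeta_six_shift : HasSum (fun n : ℕ => (1 : ℝ) / ((n : ℝ) + 1) ^ 6) (Real.pi ^ 6 / 945) := by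
  have h := hasSum_zeta_nat (k := 3) (by norm_num)
  have hb : bernoulli 6 = 1 / 42 := by
    rw [bernoulli_eq_bernoulli'_of_ne_one (by decide), bernoulli'_def]
    have h5 : bernoulli' 5 = 0 := bernoulli'_eq_zero_of_odd (by decide) (by norm_num)
    norm_num [Finset.sum_range_succ, h5, Nat.choose]
  norm_num [hb, Nat.factorial] at h
  have h4 := (hasSum_nat_add_iff' 1).mpr h
  convert! h4 using 1
  · funext n; simp
  · simp; ring

lemma zeta_two_shift : HasSum (fun n : ℕ => (1 : ℝ) / ((n : ℝ) + 1) ^ 2) (Real.pi ^ 2 / 6) := by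
  have h4 := (hasSum_nat_add_iff' 1).mpr hasSum_zeta_two
  simpa using h4

lemma zeta_four_shift : HasSum (fun n : ℕ => (1 : ℝ) / ((n : ℝ) + 1) ^ 4) (Real.pi ^ 4 / 90) := by
  have h4 := (hasSum_nat_add_iff' 1).mpr hasSum_zeta_four
  simpa using h4

/-- The symmetrizable double-series term. -/
noncomputable def dterm (p : ℕ × ℕ) : ℝ :=
  (3 * ((p.1 : ℝ) + 1) ^ 2 + ((p.2 : ℝ) + 1) ^ 2) /
    (((p.1 : ℝ) + 1) ^ 4 * (((p.1 : ℝ) + 1) ^ 2 + ((p.2 : ℝ) + 1) ^ 2) ^ 2)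

lemma dterm_symm (p : ℕ × ℕ) : dterm p + dterm p.swap =
    1 / ((p.1 : ℝ) + 1) ^ 4 * (1 / ((p.2 : ℝ) + 1) ^ 2) +
    1 / ((p.1 : ℝ) + 1) ^ 2 * (1 / ((p.2 : ℝ) + 1) ^ 4) := by
  obtain ⟨n, m⟩ := p
  simp only [dterm, Prod.swap]
  field_simp
  ring

lemma hasSum_42 : HasSum (fun p : ℕ × ℕ => 1 / ((p.1 : ℝ) + 1) ^ 4 * (1 / ((p.2 : ℝ) + 1) ^ 2))
    (Real.pi ^ 4 / 90 * (Real.pi ^ 2 / 6)) := by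
  have hf : 0 ≤ (fun n : ℕ => (1 : ℝ) / ((n : ℝ) + 1) ^ 4) := by
    intro n
    simp only [Pi.zero_apply]
    positivity
  have hg : 0 ≤ (fun n : ℕ => (1 : ℝ) / ((n : ℝ) + 1) ^ 2) := by
    intro n
    simp only [Pi.zero_apply]
    positivity
  have hs := zeta_four_shift.summable.mul_of_nonneg zeta_two_shift.summable hf hg
  exact zeta_four_shift.mul zeta_two_shift hs

lemma hasSum_24 : HasSum (fun p : ℕ × ℕ => 1 / ((p.1 : ℝ) + 1) ^ 2 * (1 / ((p.2 : ℝ) + 1) ^ 4))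
    (Real.pi ^ 2 / 6 * (Real.pi ^ 4 / 90)) := by
  have hf : 0 ≤ (fun n : ℕ => (1 : ℝ) / ((n : ℝ) + 1) ^ 2) := by
    intro n
    simp only [Pi.zero_apply]
    positivity
  have hg : 0 ≤ (fun n : ℕ => (1 : ℝ) / ((n : ℝ) + 1) ^ 4) := by
    intro n
    simp only [Pi.zero_apply]
    positivity
  have hs := zeta_two_shift.summable.mul_of_nonneg zeta_four_shift.summable hf hg
  exact zeta_two_shift.mul zeta_four_shift hs

lemma dterm_nonneg (p : ℕ × ℕ) : 0 ≤ dterm p := by unfold dterm; positivity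

lemma dterm_hasSum : HasSum dterm (Real.pi ^ 6 / 540) := by
  have hs : Summable dterm := by
    refine Summable.of_nonneg_of_le dterm_nonneg (fun p => ?_)
      (hasSum_42.add hasSum_24).summable
    rw [← dterm_symm]
    linarith [dterm_nonneg p.swap]
  have h1 := hs.hasSum
  have h2 : HasSum (fun p : ℕ × ℕ => dterm p.swap) (∑' p, dterm p) :=
    (Equiv.prodComm ℕ ℕ).hasSum_iff.mpr h1
  have h3 := h1.add h2
  simp only [dterm_symm] at h3
  have h4 := h3.unique (hasSum_42.add hasSum_24)
  have h5 : ∑' p, dterm p = Real.pi ^ 6 / 540 := by linarith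
  rw [← h5]; exact h1

/-- The combined single-series term. -/
noncomputable def sterm (k : ℕ) : ℝ :=
  1 / ((k : ℝ) + 1) ^ 5 +
    2 * (1 / (((k : ℝ) + 1) ^ 5 * (Real.exp (2 * Real.pi * ((k : ℝ) + 1)) - 1))) +
    (Real.pi / 2) * (1 / (((k : ℝ) + 1) ^ 4 * Real.sinh (Real.pi * ((k : ℝ) + 1)) ^ 2))

lemma exp_bound (k : ℕ) : 1 ≤ Real.exp (2 * Real.pi * ((k : ℝ) + 1)) - 1 := by
  have h := Real.add_one_le_exp (2 * Real.pi * ((k : ℝ) + 1))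
  have h2 : (0 : ℝ) ≤ k := by positivity
  nlinarith [Real.pi_gt_three]

lemma sinh_bound (k : ℕ) : 1 ≤ Real.sinh (Real.pi * ((k : ℝ) + 1)) := by
  have h2 : (0 : ℝ) ≤ k := by positivity
  have h := Real.self_le_sinh_iff.mpr (show 0 ≤ Real.pi * ((k : ℝ) + 1) by positivity)
  nlinarith [Real.pi_gt_three]

lemma row_hasSum (n : ℕ) : HasSum (fun m => dterm (n, m))
    (Real.pi * sterm n - 3 / 2 * (1 / ((n : ℝ) + 1) ^ 6)) := by
  have h1 := coth_hasSum ((n : ℝ) + 1) (by positivity)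
  have h2 := sinh_hasSum ((n : ℝ) + 1) (by positivity)
  have h3 := (h1.mul_left (1 / ((n : ℝ) + 1) ^ 5)).sub (h2.mul_left (1 / (2 * ((n : ℝ) + 1) ^ 4)))
  convert! h3 using 1
  · funext m
    simp only [dterm]
    field_simp
    ring
  · have a := exp_bound n
    have b := sinh_bound n
    unfold sterm
    generalize Real.exp (2 * Real.pi * ((n : ℝ) + 1)) - 1 = E at *
    generalize Real.sinh (Real.pi * ((n : ℝ) + 1)) = S at *
    have : E ≠ 0 := by positivity
    have : S ≠ 0 := by positivity
    field_simp
    ring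

lemma sterm_tsum : ∑' k, sterm k = 13 * Real.pi ^ 5 / 3780 := by
  have h1 := dterm_hasSum.prod_fiberwise row_hasSum
  have h2 := h1.add (zeta_six_shift.mul_left (3 / 2))
  have h3 := h2.mul_left (1 / Real.pi)
  have hp := Real.pi_ne_zero
  have h4 : HasSum sterm (1 / Real.pi * (Real.pi ^ 6 / 540 + 3 / 2 * (Real.pi ^ 6 / 945))) := by
    convert! h3 using 1
    funext n
    field_simp
    ring
  rw [h4.tsum_eq]
  field_simp
  norm_num


/-- `ζ(5) + 2 Σ 1/(k⁵(e^{2πk}−1)) + (π/2) Σ 1/(k⁴ sinh²(πk)) = 13π⁵/3780`. -/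
theorem zeta_five_identity :
    (∑' m : ℕ, (1 : ℝ) / ((m : ℝ) + 1) ^ 5) +
      2 * (∑' k : ℕ, (1 : ℝ) /
        (((k : ℝ) + 1) ^ 5 * (Real.exp (2 * Real.pi * ((k : ℝ) + 1)) - 1))) +
      (Real.pi / 2) * (∑' k : ℕ, (1 : ℝ) /
        (((k : ℝ) + 1) ^ 4 * Real.sinh (Real.pi * ((k : ℝ) + 1)) ^ 2)) =
      13 * Real.pi ^ 5 / 3780 := by
  have s4 := zeta_four_shift.summable
  have s5 : Summable (fun m : ℕ => (1 : ℝ) / ((m : ℝ) + 1) ^ 5) := by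
    refine Summable.of_nonneg_of_le (fun n => by positivity) (fun n => ?_) s4
    have : (1 : ℝ) ≤ (n : ℝ) + 1 := by linarith [(Nat.cast_nonneg n : (0 : ℝ) ≤ n)]
    apply one_div_le_one_div_of_le (by positivity)
    exact pow_le_pow_right₀ this (by norm_num)
  have sE : Summable (fun k : ℕ => (1 : ℝ) /
        (((k : ℝ) + 1) ^ 5 * (Real.exp (2 * Real.pi * ((k : ℝ) + 1)) - 1))) := by
    refine Summable.of_nonneg_of_le (fun n => ?_) (fun n => ?_) s5
    · have := exp_bound n
      positivity
    · apply one_div_le_one_div_of_le (by positivity)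
      exact le_mul_of_one_le_right (by positivity) (exp_bound n)
  have sS : Summable (fun k : ℕ => (1 : ℝ) /
        (((k : ℝ) + 1) ^ 4 * Real.sinh (Real.pi * ((k : ℝ) + 1)) ^ 2)) := by
    refine Summable.of_nonneg_of_le (fun n => by positivity) (fun n => ?_) s4
    apply one_div_le_one_div_of_le (by positivity)
    exact le_mul_of_one_le_right (by positivity) (one_le_pow₀ (sinh_bound n))
  have h := (((s5.hasSum).add (sE.hasSum.mul_left 2)).add
    (sS.hasSum.mul_left (Real.pi / 2))).tsum_eq
  rw [← h]
  exact sterm_tsum
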